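/- arXiv:2004.06296 — 6 statements merged into one kernel-verified Lean document; each statement's English description precedes it below -/
import Mathlib

section
/- The two largest eigenvalues of H are given explicitly by d1² = ½( n1·c11 + n2·c22 + ( n1²c11² + n2²c22² + 4n1n2c12² − 2n1n2c11c22 )^{1/2} ) and d2² = ½( n1·c11 + n2·c22 − ( n1²c11² + n2²c22² + 4n1n2c12² − 2n1n2c11c22 )^{1/2} ). -/
open Matrix Finset

/-- `d1` and `d2` are the two largest eigenvalues (with multiplicity) of the
real symmetric matrix `H`. -/
def IsTopTwoEigen {n : ℕ} (H : Matrix (Fin n) (Fin n) ℝ) (d1 d2 : ℝ) : Prop :=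
  ∃ (hH : H.IsHermitian) (i j : Fin n), i ≠ j ∧
    hH.eigenvalues i = d1 ∧ hH.eigenvalues j = d2 ∧ d2 ≤ d1 ∧
    ∀ k : Fin n, k ≠ i → k ≠ j → hH.eigenvalues k ≤ d2

theorem Matrix.IsHermitian.trace_mul_self_eq_sum_eigenvalues_sq {n : Type*} [Fintype n]
    [DecidableEq n] {A : Matrix n n ℝ} (hA : A.IsHermitian) :
    (A * A).trace = ∑ i, hA.eigenvalues i ^ 2 := by
  conv_lhs => rw [hA.spectral_theorem]
  rw [← map_mul, Unitary.conjStarAlgAut_apply, trace_mul_cycle, ← mul_assoc]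
  simp [trace_diagonal, sq]

/-- All eigenvalues of a positive semidefinite matrix of rank at most two vanish, apart from
two dominating ones. -/
theorem Matrix.PosSemidef.eigenvalues_eq_zero_of_rank_le_two {n : Type*} [Fintype n]
    [DecidableEq n] {A : Matrix n n ℝ} (hA : A.PosSemidef) (hrank : A.rank ≤ 2) {i j k : n}
    (hij : i ≠ j) (hki : k ≠ i) (hkj : k ≠ j)
    (hi : hA.1.eigenvalues k ≤ hA.1.eigenvalues i)
    (hj : hA.1.eigenvalues k ≤ hA.1.eigenvalues j) : hA.1.eigenvalues k = 0 := by
  by_contra hk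
  have hpos : 0 < hA.1.eigenvalues k := lt_of_le_of_ne (hA.eigenvalues_nonneg k) (Ne.symm hk)
  rw [hA.1.rank_eq_card_non_zero_eigs, Fintype.card_subtype] at hrank
  have hsub : ({i, j, k} : Finset n) ⊆ ({l | hA.1.eigenvalues l ≠ 0} : Finset n) := by
    intro l hl
    simp only [mem_insert, mem_singleton] at hl
    rcases hl with rfl | rfl | rfl <;> simp <;> linarith
  have hcard := card_le_card hsub
  rw [card_eq_three.mpr ⟨i, j, k, hij, hki.symm, hkj.symm, rfl⟩] at hcard
  omega

theorem top_two_eigenvalues_formula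
    (n p : ℕ) (hn : 2 ≤ n)
    (a1 : Fin n → ℝ) (ha1 : ∀ i, a1 i = 0 ∨ a1 i = 1)
    (a2 : Fin n → ℝ) (ha2 : a2 = fun i => 1 - a1 i)
    (n1 n2 : ℕ)
    (hn1 : n1 = (Finset.univ.filter (fun i => a1 i = 1)).card)
    (hn2 : n2 = n - n1)
    (hn1' : 1 ≤ n1) (hn2' : 1 ≤ n2)
    (μ1 μ2 : Fin p → ℝ) (hμ : μ1 ≠ μ2) (hμ2 : μ2 ≠ 0)
    (c11 c22 c12 : ℝ)
    (hc11 : c11 = μ1 ⬝ᵥ μ1) (hc22 : c22 = μ2 ⬝ᵥ μ2) (hc12 : c12 = μ1 ⬝ᵥ μ2)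
    (H : Matrix (Fin n) (Fin n) ℝ)
    (hH : H = c11 • vecMulVec a1 a1 + c22 • vecMulVec a2 a2 +
      c12 • (vecMulVec a1 a2 + vecMulVec a2 a1))
    (d1sq d2sq : ℝ) (htop : IsTopTwoEigen H d1sq d2sq) :
    d1sq = (1/2) * ((n1 : ℝ) * c11 + (n2 : ℝ) * c22 +
      Real.sqrt ((n1:ℝ)^2 * c11^2 + (n2:ℝ)^2 * c22^2 +
        4*(n1:ℝ)*(n2:ℝ)*c12^2 - 2*(n1:ℝ)*(n2:ℝ)*c11*c22)) ∧
    d2sq = (1/2) * ((n1 : ℝ) * c11 + (n2 : ℝ) * c22 -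
      Real.sqrt ((n1:ℝ)^2 * c11^2 + (n2:ℝ)^2 * c22^2 +
        4*(n1:ℝ)*(n2:ℝ)*c12^2 - 2*(n1:ℝ)*(n2:ℝ)*c11*c22)) := by
  obtain ⟨hHerm, i, j, hij, rfl, rfl, hle, hmax⟩ := htop
  have hcard : n1 ≤ n := by
    simpa [← hn1] using card_filter_le (univ : Finset (Fin n)) (fun i => a1 i = 1)
  have hn2R : (n2 : ℝ) = n - n1 := by rw [hn2, Nat.cast_sub hcard]
  have hsq : ∀ l, a1 l * a1 l = a1 l := fun l => by rcases ha1 l with h | h <;> simp [h]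
  have hsum : ∑ l, a1 l = n1 := by
    rw [hn1, card_filter, Nat.cast_sum]
    refine sum_congr rfl fun l _ => ?_
    rcases ha1 l with h | h <;> simp [h]
  have h11 : a1 ⬝ᵥ a1 = n1 := by simp [dotProduct, hsq, hsum]
  have h12 : a1 ⬝ᵥ a2 = 0 := by simp [dotProduct, ha2, mul_sub, hsq]
  have h21 : a2 ⬝ᵥ a1 = 0 := by rw [dotProduct_comm, h12]
  have h22 : a2 ⬝ᵥ a2 = n2 := by
    simp [dotProduct, ha2, mul_sub, sub_mul, hsq, hsum, hn2R]
  have hpsd : H.PosSemidef := by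
    convert posSemidef_conjTranspose_mul_self (vecMulVec μ1 a1 + vecMulVec μ2 a2) using 1
    rw [hH, hc11, hc22, hc12]
    simp only [conjTranspose_add, conjTranspose_vecMulVec, star_trivial,
      Matrix.add_mul, Matrix.mul_add,
      vecMulVec_mul_vecMulVec, vecMulVec_smul, smul_add, dotProduct_comm μ2 μ1]
    abel
  have hrank : H.rank ≤ 2 := by
    have hfac : H = (of fun l => ![a1 l, a2 l]) *
        of ![c11 • a1 + c12 • a2, c12 • a1 + c22 • a2] := by
      ext l m
      simp [hH, mul_apply, vecMulVec_apply]
      ring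
    rw [hfac]
    exact (rank_mul_le_left _ _).trans (rank_le_width _)
  have htrace : H.trace = n1 * c11 + n2 * c22 := by
    simp [hH, trace_vecMulVec, h11, h12, h21, h22]
    ring
  have htrace_sq : (H * H).trace = n1 ^ 2 * c11 ^ 2 + n2 ^ 2 * c22 ^ 2 + 2 * n1 * n2 * c12 ^ 2 := by
    simp [hH, add_mul, mul_add, vecMulVec_mul_vecMulVec, trace_vecMulVec, h11, h12, h21, h22]
    ring
  have hzero : ∀ k, k ≠ i ∧ k ≠ j → hHerm.eigenvalues k = 0 := fun k hk =>
    hpsd.eigenvalues_eq_zero_of_rank_le_two hrank hij hk.1 hk.2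
      ((hmax k hk.1 hk.2).trans hle) (hmax k hk.1 hk.2)
  have hadd := hHerm.trace_eq_sum_eigenvalues
  rw [htrace, Fintype.sum_eq_add i j hij fun k hk => by simp [hzero k hk]] at hadd
  have hadd_sq := hHerm.trace_mul_self_eq_sum_eigenvalues_sq
  rw [htrace_sq, Fintype.sum_eq_add i j hij fun k hk => by simp [hzero k hk]] at hadd_sq
  simp only [RCLike.ofReal_real_eq_id, id] at hadd
  have hdisc : (n1 : ℝ) ^ 2 * c11 ^ 2 + (n2 : ℝ) ^ 2 * c22 ^ 2 + 4 * (n1 : ℝ) * (n2 : ℝ) * c12 ^ 2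
      - 2 * (n1 : ℝ) * (n2 : ℝ) * c11 * c22
      = (hHerm.eigenvalues i - hHerm.eigenvalues j) ^ 2 := by
    linear_combination 2 * hadd_sq -
      (n1 * c11 + n2 * c22 + hHerm.eigenvalues i + hHerm.eigenvalues j) * hadd
  rw [hdisc, Real.sqrt_sq (sub_nonneg.mpr hle)]
  constructor <;> linarith
end

section
/- If c12² = c11·c22, then d1² = n1·c11 + n2·c22, d2² = 0, and every eigenvector u1 of H corresponding to the eigenvalue d1² has clustering power (its eigenvalue is positive and its coordinates take exactly two distinct values); in particular no eigenvector corresponding to d2² has clustering power. -/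
open Matrix Finset

/-- A vector `u` (an eigenvector with eigenvalue `d`) has clustering power if `d > 0` and
the coordinates of `u` take exactly two distinct values. -/
def HasClusteringPower {n : ℕ} (u : Fin n → ℝ) (d : ℝ) : Prop :=
  0 < d ∧ (Finset.univ.image u).card = 2

theorem eq_smul_of_smul_vecMulVec_mulVec_eq {ι : Type*} [Fintype ι] {w u : ι → ℝ} {c d : ℝ}
    (hd : d ≠ 0) (h : (c • vecMulVec w w) *ᵥ u = d • u) :
    u = (d⁻¹ * (c * (w ⬝ᵥ u))) • w := by
  rw [smul_mulVec, vecMulVec_mulVec] at h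
  ext i
  have hi := congrFun h i
  simp only [Pi.smul_apply, smul_eq_mul, MulOpposite.smul_eq_mul_unop,
    MulOpposite.unop_op] at hi ⊢
  field_simp
  linarith

theorem eq_mul_dotProduct_of_smul_vecMulVec_mulVec_eq {ι : Type*} [Fintype ι] {w u : ι → ℝ}
    {c d : ℝ} (hd : d ≠ 0) (hu : u ≠ 0) (h : (c • vecMulVec w w) *ᵥ u = d • u) :
    d = c * (w ⬝ᵥ w) := by
  have hw := eq_smul_of_smul_vecMulVec_mulVec_eq hd h
  have hwu : w ⬝ᵥ u ≠ 0 := by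
    intro h0
    apply hu
    rw [hw, h0]
    simp
  have h1 := congrArg (fun v => w ⬝ᵥ v) hw
  simp only [dotProduct_smul, smul_eq_mul] at h1
  field_simp at h1
  linarith

theorem IsTopTwoEigen.of_smul_vecMulVec {n : ℕ} {w : Fin n → ℝ} {c d1 d2 : ℝ}
    (hpos : 0 < c * (w ⬝ᵥ w)) (htop : IsTopTwoEigen (c • vecMulVec w w) d1 d2) :
    d1 = c * (w ⬝ᵥ w) ∧ d2 = 0 := by
  obtain ⟨hH, i, j, hij, rfl, rfl, hle, hrest⟩ := htop
  have hval : ∀ k, hH.eigenvalues k = 0 ∨ hH.eigenvalues k = c * (w ⬝ᵥ w) := by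
    intro k
    by_cases h0 : hH.eigenvalues k = 0
    · exact Or.inl h0
    · refine Or.inr (eq_mul_dotProduct_of_smul_vecMulVec_mulVec_eq h0 ?_
        (hH.mulVec_eigenvectorBasis k))
      intro hz
      apply hH.eigenvectorBasis.orthonormal.ne_zero k
      ext l
      exact congrFun hz l
  have hnn : ∀ k, 0 ≤ hH.eigenvalues k := by
    intro k
    rcases hval k with h | h <;> rw [h]
    exact hpos.le
  have hsum : ∑ k, hH.eigenvalues k = c * (w ⬝ᵥ w) := by
    have h := hH.trace_eq_sum_eigenvalues
    rw [trace_smul, trace_vecMulVec, smul_eq_mul] at h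
    simpa using h.symm
  have hi : hH.eigenvalues i = c * (w ⬝ᵥ w) := by
    refine (hval i).resolve_left fun h0 => ?_
    have hall : ∀ k, hH.eigenvalues k ≤ 0 := by
      intro k
      rw [← h0]
      by_cases hki : k = i
      · rw [hki]
      by_cases hkj : k = j
      · rwa [hkj]
      exact (hrest k hki hkj).trans hle
    have := Finset.sum_nonpos fun k (_ : k ∈ Finset.univ) => hall k
    linarith
  refine ⟨hi, le_antisymm ?_ (hnn j)⟩
  have hpair := Finset.sum_le_univ_sum_of_nonneg hnn (s := {i, j})
  rw [Finset.sum_pair hij] at hpair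
  linarith

theorem degenerate_case_clustering_power
    (n p : ℕ) (hn : 2 ≤ n)
    (a1 : Fin n → ℝ) (ha1 : ∀ i, a1 i = 0 ∨ a1 i = 1)
    (a2 : Fin n → ℝ) (ha2 : a2 = fun i => 1 - a1 i)
    (n1 n2 : ℕ)
    (hn1 : n1 = (Finset.univ.filter (fun i => a1 i = 1)).card)
    (hn2 : n2 = n - n1)
    (hn1p : 1 ≤ n1) (hn2p : 1 ≤ n2)
    (μ1 μ2 : Fin p → ℝ) (hμ : μ1 ≠ μ2) (hμ2 : μ2 ≠ 0)
    (c11 c22 c12 : ℝ)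
    (hc11 : c11 = μ1 ⬝ᵥ μ1) (hc22 : c22 = μ2 ⬝ᵥ μ2) (hc12 : c12 = μ1 ⬝ᵥ μ2)
    (H : Matrix (Fin n) (Fin n) ℝ)
    (hH : H = c11 • vecMulVec a1 a1 + c22 • vecMulVec a2 a2 +
      c12 • (vecMulVec a1 a2 + vecMulVec a2 a1))
    (d1sq d2sq : ℝ) (htop : IsTopTwoEigen H d1sq d2sq)
    (hdeg : c12 ^ 2 = c11 * c22) :
    d1sq = (n1 : ℝ) * c11 + (n2 : ℝ) * c22 ∧ d2sq = 0 ∧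
    (∀ u : Fin n → ℝ, u ≠ 0 → H *ᵥ u = d1sq • u → HasClusteringPower u d1sq) ∧
    (∀ u : Fin n → ℝ, u ≠ 0 → H *ᵥ u = d2sq • u → ¬ HasClusteringPower u d2sq) := by
  have h22 : 0 < c22 := by
    rw [hc22]
    exact lt_of_le_of_ne (Finset.sum_nonneg fun i _ => mul_self_nonneg (μ2 i))
      fun h => hμ2 (dotProduct_self_eq_zero.mp h.symm)
  have hne : c12 ≠ c22 := by
    intro h
    have h11 : c11 = c22 := by
      apply mul_right_cancel₀ h22.ne'
      rw [← hdeg, h]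
      ring
    apply hμ
    rw [← sub_eq_zero, ← dotProduct_self_eq_zero]
    simp only [sub_dotProduct, dotProduct_sub]
    rw [dotProduct_comm μ2 μ1, ← hc11, ← hc12, ← hc22]
    linarith
  obtain ⟨t, rfl⟩ : ∃ t, c12 = t * c22 := ⟨c12 / c22, by field_simp⟩
  have ht : t ≠ 1 := fun h => hne (by rw [h, one_mul])
  obtain rfl : c11 = t ^ 2 * c22 := by
    apply mul_right_cancel₀ h22.ne'
    rw [← hdeg]
    ring
  set w : Fin n → ℝ := fun i => t * a1 i + a2 i with hw
  have hHw : H = c22 • vecMulVec w w := by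
    rw [hH]
    ext i j
    simp only [hw, Matrix.add_apply, Matrix.smul_apply, vecMulVec_apply, smul_eq_mul]
    ring
  have hle : n1 ≤ n := by
    rw [hn1]
    exact (Finset.card_filter_le _ _).trans_eq (Finset.card_fin n)
  have hsum : ∑ i, a1 i = n1 := by
    rw [hn1, Finset.card_filter, Nat.cast_sum]
    refine Finset.sum_congr rfl fun i _ => ?_
    rcases ha1 i with h | h <;> simp [h]
  have hww : w ⬝ᵥ w = t ^ 2 * n1 + n2 := by
    have hterm : ∀ i, w i * w i = (t ^ 2 - 1) * a1 i + 1 := by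
      intro i
      simp only [hw, ha2]
      rcases ha1 i with h | h <;> rw [h] <;> ring
    simp only [dotProduct, hterm]
    rw [Finset.sum_add_distrib, ← Finset.mul_sum, hsum, hn2, Nat.cast_sub hle]
    simp
    ring
  have hn2' : (0 : ℝ) < n2 := by exact_mod_cast hn2p
  have hpos : 0 < c22 * (w ⬝ᵥ w) := by
    rw [hww]
    positivity
  subst hHw
  obtain ⟨rfl, rfl⟩ := htop.of_smul_vecMulVec hpos
  refine ⟨by rw [hww]; ring, rfl, fun u hu hHu => ⟨hpos, ?_⟩, fun u _ _ h => h.1.false⟩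
  have huw := eq_smul_of_smul_vecMulVec_mulVec_eq hpos.ne' hHu
  generalize (c22 * (w ⬝ᵥ w))⁻¹ * (c22 * (w ⬝ᵥ u)) = s at huw
  have hs : s ≠ 0 := by
    rintro rfl
    exact hu (by rw [huw, zero_smul])
  obtain ⟨i, hi⟩ : ∃ i, a1 i = 1 := by
    obtain ⟨i, hi⟩ := Finset.card_pos.mp (hn1 ▸ hn1p)
    exact ⟨i, (Finset.mem_filter.mp hi).2⟩
  obtain ⟨j, hj⟩ : ∃ j, a1 j = 0 := by
    by_contra! h
    have hall : ∀ k, a1 k = 1 := fun k => (ha1 k).resolve_left (h k)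
    simp [hall] at hn1
    omega
  have himg : Finset.univ.image u = {s * t, s} := by
    ext x
    simp only [Finset.mem_image, Finset.mem_univ, true_and, Finset.mem_insert,
      Finset.mem_singleton]
    constructor
    · rintro ⟨k, rfl⟩
      rcases ha1 k with h | h
      · right; simp [huw, hw, ha2, h]
      · left; simp [huw, hw, ha2, h]
    · rintro (rfl | rfl)
      · exact ⟨i, by simp [huw, hw, ha2, hi]⟩
      · exact ⟨j, by simp [huw, hw, ha2, hj]⟩
  rw [himg, Finset.card_pair]
  intro h
  exact ht (mul_left_cancel₀ hs (by rw [h, mul_one]))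
end

section
/- If c12 = 0, c11·c22 ≠ 0 and n1·c11 = n2·c22, then d1² = d2² = n1·c11 > 0 (the top eigenvalue of H has multiplicity at least two), and for any two mutually orthogonal eigenvectors u1 and u2 of H corresponding to the eigenvalue n1·c11, at least one of u1 and u2 has clustering power. -/
open Matrix Finset

/-- Action of a combination of two rank-one symmetric matrices on a vector. -/
lemma smul_vecMulVec_add_mulVec {ι : Type*} [Fintype ι] (a b v : ι → ℝ) (s t : ℝ) :
    (s • vecMulVec a a + t • vecMulVec b b) *ᵥ v =
      (s * (a ⬝ᵥ v)) • a + (t * (b ⬝ᵥ v)) • b := by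
  ext i
  simp [add_mulVec, smul_mulVec, vecMulVec_mulVec]
  ring

/-- If `a` and `b` are orthogonal with `s ‖a‖² = t ‖b‖² = d`, the only eigenvalues of
`s a aᵀ + t b bᵀ` are `0` and `d`. -/
lemma eigenvalue_eq_zero_or_eq {ι : Type*} [Fintype ι] {a b v : ι → ℝ} {s t d l : ℝ}
    (hab : a ⬝ᵥ b = 0) (ha : s * (a ⬝ᵥ a) = d) (hb : t * (b ⬝ᵥ b) = d) (hv : v ≠ 0)
    (h : (s • vecMulVec a a + t • vecMulVec b b) *ᵥ v = l • v) : l = 0 ∨ l = d := by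
  rw [smul_vecMulVec_add_mulVec] at h
  by_contra! hl
  have hld : l - d ≠ 0 := sub_ne_zero.2 hl.2
  have hav : a ⬝ᵥ v = 0 := by
    have := congrArg (a ⬝ᵥ ·) h
    simp only [dotProduct_add, dotProduct_smul, hab, smul_eq_mul] at this
    refine (mul_eq_zero.1 (?_ : (l - d) * (a ⬝ᵥ v) = 0)).resolve_left hld
    rw [← ha]; linarith
  have hbv : b ⬝ᵥ v = 0 := by
    have := congrArg (b ⬝ᵥ ·) h
    simp only [dotProduct_add, dotProduct_smul, dotProduct_comm b a, hab, smul_eq_mul] at this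
    refine (mul_eq_zero.1 (?_ : (l - d) * (b ⬝ᵥ v) = 0)).resolve_left hld
    rw [← hb]; linarith
  simp only [hav, hbv, mul_zero, zero_smul, add_zero] at h
  exact (smul_ne_zero hl.1 hv) h.symm

/-- If every eigenvalue is `0` or `d > 0` and the trace is `2 d`, then the two largest
eigenvalues both equal `d`. -/
lemma IsTopTwoEigen.eq_of_trace {n : ℕ} {H : Matrix (Fin n) (Fin n) ℝ} {d1 d2 d : ℝ}
    (h : IsTopTwoEigen H d1 d2) (hd : 0 < d) (htr : H.trace = 2 * d)
    (hev : ∀ (v : Fin n → ℝ) (l : ℝ), v ≠ 0 → H *ᵥ v = l • v → l = 0 ∨ l = d) :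
    d1 = d ∧ d2 = d := by
  obtain ⟨hH, i, j, hij, rfl, rfl, hle, hk⟩ := h
  have hev' (k : Fin n) : hH.eigenvalues k = 0 ∨ hH.eigenvalues k = d := by
    refine hev _ _ ?_ (hH.mulVec_eigenvectorBasis k)
    intro h0
    exact hH.eigenvectorBasis.toBasis.ne_zero k (by ext x; simpa using congrFun h0 x)
  have hsum : ∑ k, hH.eigenvalues k = 2 * d := by
    rw [← htr, hH.trace_eq_sum_eigenvalues]; simp
  have hj : hH.eigenvalues j = d := by
    refine (hev' j).resolve_left fun h0 => ?_
    have hrest : ∑ k ∈ univ.erase i, hH.eigenvalues k ≤ 0 := by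
      refine sum_nonpos fun k hki => ?_
      rcases eq_or_ne k j with rfl | hkj
      · exact h0.le
      · exact (hk k (ne_of_mem_erase hki) hkj).trans h0.le
    rw [← add_sum_erase _ _ (mem_univ i)] at hsum
    rcases hev' i with h | h <;> linarith
  refine ⟨?_, hj⟩
  rcases hev' i with h | h <;> linarith

/-- A vector that takes the value `x` on the nonempty set where `a = 1` and `y` on the nonempty
set where `a = 0` is either two-valued or constant. -/
lemma card_image_eq_two_or_eq_const {ι : Type*} [Fintype ι] {a u : ι → ℝ}
    (ha : ∀ i, a i = 0 ∨ a i = 1) (h1 : ∃ i, a i = 1) (h0 : ∃ i, a i = 0)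
    {x y : ℝ} (hu : ∀ i, u i = x * a i + y * (1 - a i)) :
    (univ.image u).card = 2 ∨ u = fun _ => x := by
  rcases eq_or_ne x y with rfl | hxy
  · right
    ext i
    rw [hu]; ring
  · left
    have : univ.image u = {x, y} := by
      ext z
      simp only [mem_image, mem_univ, true_and, mem_insert, mem_singleton]
      constructor
      · rintro ⟨i, rfl⟩
        rcases ha i with h | h <;> simp [hu, h]
      · obtain ⟨i, hi⟩ := h1
        obtain ⟨j, hj⟩ := h0
        rintro (rfl | rfl)
        · exact ⟨i, by simp [hu, hi]⟩
        · exact ⟨j, by simp [hu, hj]⟩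
    rw [this, card_pair hxy]

theorem multiplicity_case_clustering_power
    (n p : ℕ) (hn : 2 ≤ n)
    (a1 : Fin n → ℝ) (ha1 : ∀ i, a1 i = 0 ∨ a1 i = 1)
    (a2 : Fin n → ℝ) (ha2 : a2 = fun i => 1 - a1 i)
    (n1 n2 : ℕ)
    (hn1 : n1 = (Finset.univ.filter (fun i => a1 i = 1)).card)
    (hn2 : n2 = n - n1)
    (hn1p : 1 ≤ n1) (hn2p : 1 ≤ n2)
    (μ1 μ2 : Fin p → ℝ) (hμ : μ1 ≠ μ2) (hμ2 : μ2 ≠ 0)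
    (c11 c22 c12 : ℝ)
    (hc11 : c11 = μ1 ⬝ᵥ μ1) (hc22 : c22 = μ2 ⬝ᵥ μ2) (hc12 : c12 = μ1 ⬝ᵥ μ2)
    (H : Matrix (Fin n) (Fin n) ℝ)
    (hH : H = c11 • vecMulVec a1 a1 + c22 • vecMulVec a2 a2 +
      c12 • (vecMulVec a1 a2 + vecMulVec a2 a1))
    (d1sq d2sq : ℝ) (htop : IsTopTwoEigen H d1sq d2sq)
    (h12 : c12 = 0) (hne : c11 * c22 ≠ 0)
    (heq : (n1 : ℝ) * c11 = (n2 : ℝ) * c22) :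
    d1sq = (n1 : ℝ) * c11 ∧ d2sq = (n1 : ℝ) * c11 ∧ 0 < (n1 : ℝ) * c11 ∧
    ∀ u1 u2 : Fin n → ℝ, u1 ≠ 0 → u2 ≠ 0 →
      H *ᵥ u1 = ((n1 : ℝ) * c11) • u1 → H *ᵥ u2 = ((n1 : ℝ) * c11) • u2 →
      u1 ⬝ᵥ u2 = 0 →
      HasClusteringPower u1 ((n1 : ℝ) * c11) ∨ HasClusteringPower u2 ((n1 : ℝ) * c11) := by
  have hle : n1 ≤ n := by
    rw [hn1]
    simpa using card_filter_le (univ : Finset (Fin n)) (fun i => a1 i = 1)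
  have hval (i : Fin n) : a2 i = 1 - a1 i := by rw [ha2]
  have hsum : ∑ i, a1 i = n1 := by
    rw [hn1, ← sum_boole]
    refine sum_congr rfl fun i _ => ?_
    rcases ha1 i with h | h <;> simp [h]
  have h11 : a1 ⬝ᵥ a1 = n1 := by
    rw [← hsum]
    refine sum_congr rfl fun i _ => ?_
    rcases ha1 i with h | h <;> simp [h]
  have h22 : a2 ⬝ᵥ a2 = n2 := by
    have : a2 ⬝ᵥ a2 = ∑ i, (1 - a1 i) := by
      refine sum_congr rfl fun i _ => ?_
      rcases ha1 i with h | h <;> simp [hval, h]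
    rw [this, sum_sub_distrib, hsum, hn2, Nat.cast_sub hle]
    simp
  have h12' : a1 ⬝ᵥ a2 = 0 := by
    refine sum_eq_zero fun i _ => ?_
    rcases ha1 i with h | h <;> simp [hval, h]
  have hex1 : ∃ i, a1 i = 1 := by
    obtain ⟨i, hi⟩ := card_pos.1 (hn1 ▸ hn1p)
    exact ⟨i, (mem_filter.1 hi).2⟩
  have hex0 : ∃ i, a1 i = 0 := by
    by_contra! h
    have : ∀ i, a1 i = 1 := fun i => (ha1 i).resolve_left (h i)
    simp only [this, filter_true, card_univ, Fintype.card_fin] at hn1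
    omega
  have hpos : 0 < (n1 : ℝ) * c11 := by
    have hc : 0 ≤ c11 := hc11 ▸ sum_nonneg fun i _ => mul_self_nonneg (μ1 i)
    have : (0 : ℝ) < n1 := by exact_mod_cast hn1p
    exact mul_pos this (hc.lt_of_ne' (left_ne_zero_of_mul hne))
  rw [h12, zero_smul, add_zero] at hH
  have htr : H.trace = 2 * ((n1 : ℝ) * c11) := by
    rw [hH, trace_add, trace_smul, trace_smul, trace_vecMulVec, trace_vecMulVec, h11, h22,
      smul_eq_mul, smul_eq_mul]
    linarith
  obtain ⟨hd1, hd2⟩ := htop.eq_of_trace hpos htr fun v l hv h =>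
    eigenvalue_eq_zero_or_eq h12' (by rw [h11, mul_comm]) (by rw [h22, heq, mul_comm]) hv
      (hH ▸ h)
  refine ⟨hd1, hd2, hpos, fun u1 u2 hu1 hu2 he1 he2 horth => ?_⟩
  have key (u : Fin n → ℝ) (he : H *ᵥ u = ((n1 : ℝ) * c11) • u) :
      HasClusteringPower u ((n1 : ℝ) * c11) ∨ ∃ x : ℝ, u = fun _ => x := by
    rw [hH, smul_vecMulVec_add_mulVec] at he
    have hu (i : Fin n) : u i = c11 * (a1 ⬝ᵥ u) / (n1 * c11) * a1 i +
        c22 * (a2 ⬝ᵥ u) / (n1 * c11) * (1 - a1 i) := by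
      have := congrFun he i
      simp only [Pi.add_apply, Pi.smul_apply, smul_eq_mul, hval] at this
      rw [div_mul_eq_mul_div, div_mul_eq_mul_div, ← add_div, this,
        mul_div_cancel_left₀ _ hpos.ne']
    rcases card_image_eq_two_or_eq_const ha1 hex1 hex0 hu with h | h
    · exact .inl ⟨hpos, h⟩
    · exact .inr ⟨_, h⟩
  rcases key u1 he1 with h | ⟨x, rfl⟩
  · exact .inl h
  rcases key u2 he2 with h | ⟨y, rfl⟩
  · exact .inr h
  have hx : x ≠ 0 := by
    rintro rfl
    exact hu1 rfl
  have hy : y ≠ 0 := by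
    rintro rfl
    exact hu2 rfl
  have hn0 : n ≠ 0 := by omega
  simp [dotProduct, hx, hy, hn0] at horth
end

section
/- If c12 = 0, c11·c22 ≠ 0 and n1·c11 ≠ n2·c22, then d1² = max{n1·c11, n2·c22}, d2² = min{n1·c11, n2·c22} > 0, and every eigenvector of H corresponding to d1² as well as every eigenvector of H corresponding to d2² has clustering power. -/
open Matrix Finset

/-- A symmetric matrix attains each of its eigenvalues among `IsHermitian.eigenvalues`. -/
theorem Matrix.IsHermitian.exists_eigenvalues_eq_of_mulVec_eq_smul {n : ℕ}
    {H : Matrix (Fin n) (Fin n) ℝ} (hH : H.IsHermitian) {v : Fin n → ℝ} (hv : v ≠ 0) {d : ℝ}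
    (h : H *ᵥ v = d • v) : ∃ k, hH.eigenvalues k = d := by
  have hd : d ∈ spectrum ℝ H := by
    rw [← Matrix.spectrum_toLin']
    exact (Module.End.hasEigenvalue_of_hasEigenvector
      ⟨Module.End.mem_eigenspace_iff.mpr (by simpa using h), hv⟩).mem_spectrum
  rwa [hH.spectrum_real_eq_range_eigenvalues] at hd

/-- An eigenvector, for a nonzero eigenvalue, of a combination of two orthogonal rank-one
projections with distinct eigenvalues is a multiple of one of the two generating vectors. -/
theorem eq_smul_of_orthogonal_rank_two_mulVec_eq {n : ℕ} {a b u : Fin n → ℝ} {x y d : ℝ}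
    (hab : a ⬝ᵥ b = 0) (hne : x * (a ⬝ᵥ a) ≠ y * (b ⬝ᵥ b)) (hd : d ≠ 0) (hu : u ≠ 0)
    (h : (x • vecMulVec a a + y • vecMulVec b b) *ᵥ u = d • u) :
    (d = x * (a ⬝ᵥ a) ∧ ∃ t : ℝ, t ≠ 0 ∧ u = t • a) ∨
      (d = y * (b ⬝ᵥ b) ∧ ∃ t : ℝ, t ≠ 0 ∧ u = t • b) := by
  have hexp : d • u = (x * (a ⬝ᵥ u)) • a + (y * (b ⬝ᵥ u)) • b := by
    rw [← h]
    simp [add_mulVec, smul_mulVec, vecMulVec_mulVec, smul_smul]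
  have hu' : u = (d⁻¹ * (x * (a ⬝ᵥ u))) • a + (d⁻¹ * (y * (b ⬝ᵥ u))) • b := by
    rw [mul_smul d⁻¹, mul_smul d⁻¹, ← smul_add, ← hexp, smul_smul, inv_mul_cancel₀ hd, one_smul]
  have hA : d * (a ⬝ᵥ u) = x * (a ⬝ᵥ a) * (a ⬝ᵥ u) := by
    have := congrArg (a ⬝ᵥ ·) hexp
    simp only [dotProduct_add, dotProduct_smul, smul_eq_mul, hab] at this
    linarith
  have hB : d * (b ⬝ᵥ u) = y * (b ⬝ᵥ b) * (b ⬝ᵥ u) := by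
    have := congrArg (b ⬝ᵥ ·) hexp
    simp only [dotProduct_add, dotProduct_smul, smul_eq_mul, dotProduct_comm b a, hab] at this
    linarith
  by_cases hau : a ⬝ᵥ u = 0
  · right
    simp only [hau, mul_zero, zero_smul, zero_add] at hu'
    have hbu : b ⬝ᵥ u ≠ 0 := fun h0 => hu (by simpa [h0] using hu')
    refine ⟨mul_right_cancel₀ hbu hB, _, fun h0 => hu ?_, hu'⟩
    rw [hu', h0, zero_smul]
  · left
    have hda := mul_right_cancel₀ hau hA
    have hbu : b ⬝ᵥ u = 0 := by
      by_contra hbu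
      exact hne (hda.symm.trans (mul_right_cancel₀ hbu hB))
    simp only [hbu, mul_zero, zero_smul, add_zero] at hu'
    refine ⟨hda, _, fun h0 => hu ?_, hu'⟩
    rw [hu', h0, zero_smul]

/-- If the eigenspace of `d` is spanned by a single vector, then `d` occurs at most once among
the eigenvalues. -/
theorem Matrix.IsHermitian.eq_of_eigenvalues_eq_of_forall_eq_smul {n : ℕ}
    {H : Matrix (Fin n) (Fin n) ℝ} (hH : H.IsHermitian) {d : ℝ} {a : Fin n → ℝ}
    (hspan : ∀ u : Fin n → ℝ, u ≠ 0 → H *ᵥ u = d • u → ∃ t : ℝ, t ≠ 0 ∧ u = t • a)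
    {k l : Fin n} (hk : hH.eigenvalues k = d) (hl : hH.eigenvalues l = d) : k = l := by
  have hmul : ∀ m, hH.eigenvalues m = d →
      ∃ t : ℝ, t ≠ 0 ∧ (hH.eigenvectorBasis m).ofLp = t • a := fun m hm =>
    hspan _ (fun h0 => hH.eigenvectorBasis.orthonormal.ne_zero m (WithLp.ofLp_injective 2 h0))
      (by rw [hH.mulVec_eigenvectorBasis, hm])
  obtain ⟨s, hs, hks⟩ := hmul k hk
  obtain ⟨t, ht, hlt⟩ := hmul l hl
  by_contra hkl
  have hinner : inner ℝ (hH.eigenvectorBasis k) (hH.eigenvectorBasis l) = 0 :=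
    hH.eigenvectorBasis.orthonormal.2 hkl
  rw [EuclideanSpace.inner_eq_star_dotProduct, hks, hlt] at hinner
  have ha : a = 0 := by simpa [hs, ht] using hinner
  refine hH.eigenvectorBasis.orthonormal.ne_zero k (WithLp.ofLp_injective 2 ?_)
  rw [hks, ha, smul_zero]
  rfl

/-- A nonzero multiple of a nonconstant `0`-`1` vector takes exactly two values. -/
theorem card_image_smul_zero_one {n : ℕ} {a : Fin n → ℝ} (ha : ∀ i, a i = 0 ∨ a i = 1)
    (h0 : ∃ i, a i = 0) (h1 : ∃ i, a i = 1) {t : ℝ} (ht : t ≠ 0) :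
    (Finset.univ.image (t • a)).card = 2 := by
  obtain ⟨i, hi⟩ := h0
  obtain ⟨j, hj⟩ := h1
  have himage : Finset.univ.image (t • a) = {0, t} := by
    ext z
    simp only [mem_image, mem_univ, true_and, Pi.smul_apply, smul_eq_mul, mem_insert,
      mem_singleton]
    constructor
    · rintro ⟨k, rfl⟩
      rcases ha k with hk | hk <;> simp [hk]
    · rintro (rfl | rfl)
      · exact ⟨i, by simp [hi]⟩
      · exact ⟨j, by simp [hj]⟩
  rw [himage, card_pair ht.symm]

theorem dotProduct_self_zero_one {n : ℕ} {a : Fin n → ℝ} (ha : ∀ i, a i = 0 ∨ a i = 1) :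
    a ⬝ᵥ a = ((Finset.univ.filter (fun i => a i = 1)).card : ℝ) := by
  rw [card_filter, Nat.cast_sum]
  refine sum_congr rfl fun i _ => ?_
  rcases ha i with hi | hi <;> simp [hi]

/-- If two distinct positive numbers each occur exactly once in a family whose other members
vanish, they are the two largest members. -/
theorem top_two_eq_max_min {n : ℕ} {lam : Fin n → ℝ} {x y : ℝ} (hx : 0 < x) (hy : 0 < y)
    (hxy : x ≠ y) (hval : ∀ k, lam k = 0 ∨ lam k = x ∨ lam k = y)
    (hex : ∃ k, lam k = x) (hey : ∃ k, lam k = y)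
    (hux : ∀ k l, lam k = x → lam l = x → k = l) (huy : ∀ k l, lam k = y → lam l = y → k = l)
    {i j : Fin n} (hij : i ≠ j) (hle : lam j ≤ lam i)
    (htop : ∀ k, k ≠ i → k ≠ j → lam k ≤ lam j) :
    lam i = max x y ∧ lam j = min x y := by
  obtain ⟨k, hk⟩ := hex
  obtain ⟨l, hl⟩ := hey
  grind

theorem orthogonal_distinct_case_clustering_power
    (n p : ℕ) (hn : 2 ≤ n)
    (a1 : Fin n → ℝ) (ha1 : ∀ i, a1 i = 0 ∨ a1 i = 1)
    (a2 : Fin n → ℝ) (ha2 : a2 = fun i => 1 - a1 i)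
    (n1 n2 : ℕ)
    (hn1 : n1 = (Finset.univ.filter (fun i => a1 i = 1)).card)
    (hn2 : n2 = n - n1)
    (hn1p : 1 ≤ n1) (hn2p : 1 ≤ n2)
    (μ1 μ2 : Fin p → ℝ) (hμ : μ1 ≠ μ2) (hμ2 : μ2 ≠ 0)
    (c11 c22 c12 : ℝ)
    (hc11 : c11 = μ1 ⬝ᵥ μ1) (hc22 : c22 = μ2 ⬝ᵥ μ2) (hc12 : c12 = μ1 ⬝ᵥ μ2)
    (H : Matrix (Fin n) (Fin n) ℝ)
    (hH : H = c11 • vecMulVec a1 a1 + c22 • vecMulVec a2 a2 +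
      c12 • (vecMulVec a1 a2 + vecMulVec a2 a1))
    (d1sq d2sq : ℝ) (htop : IsTopTwoEigen H d1sq d2sq)
    (h12 : c12 = 0) (hne : c11 * c22 ≠ 0)
    (hne2 : (n1 : ℝ) * c11 ≠ (n2 : ℝ) * c22) :
    d1sq = max ((n1 : ℝ) * c11) ((n2 : ℝ) * c22) ∧
    d2sq = min ((n1 : ℝ) * c11) ((n2 : ℝ) * c22) ∧ 0 < d2sq ∧
    (∀ u : Fin n → ℝ, u ≠ 0 → H *ᵥ u = d1sq • u → HasClusteringPower u d1sq) ∧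
    (∀ u : Fin n → ℝ, u ≠ 0 → H *ᵥ u = d2sq • u → HasClusteringPower u d2sq) := by
  have hortho : a1 ⬝ᵥ a2 = 0 := by
    refine sum_eq_zero fun i _ => ?_
    rcases ha1 i with hi | hi <;> simp [ha2, hi]
  have ha2' : ∀ i, a2 i = 0 ∨ a2 i = 1 := fun i => by
    rcases ha1 i with hi | hi <;> simp [ha2, hi]
  have hs1 : a1 ⬝ᵥ a1 = n1 := by rw [dotProduct_self_zero_one ha1, hn1]
  have hs2 : a2 ⬝ᵥ a2 = n2 := by
    rw [dotProduct_self_zero_one ha2', hn2, hn1]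
    have hcard := card_filter_add_card_filter_not (s := univ) (fun i => a1 i = 1)
    rw [card_univ, Fintype.card_fin] at hcard
    have hfilter : univ.filter (fun i => a2 i = 1) = univ.filter (fun i => ¬ a1 i = 1) := by
      ext i
      rcases ha1 i with hi | hi <;> simp [ha2, hi]
    rw [hfilter]
    congr 1
    omega
  have hone1 : ∃ i, a1 i = 1 := by
    obtain ⟨i, hi⟩ := card_pos.mp (show 0 < _ from hn1 ▸ hn1p)
    exact ⟨i, (mem_filter.mp hi).2⟩
  have hzero1 : ∃ i, a1 i = 0 := by
    by_contra! hall
    have ha2z : a2 = 0 := by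
      ext i
      simp [ha2, (ha1 i).resolve_left (hall i)]
    rw [ha2z, dotProduct_zero] at hs2
    have : n2 = 0 := by exact_mod_cast hs2.symm
    omega
  have hone2 : ∃ i, a2 i = 1 := hzero1.imp fun i hi => by simp [ha2, hi]
  have hzero2 : ∃ i, a2 i = 0 := hone1.imp fun i hi => by simp [ha2, hi]
  have hc11p : 0 < c11 := (left_ne_zero_of_mul hne).symm.lt_of_le
    (hc11 ▸ sum_nonneg fun i _ => mul_self_nonneg _)
  have hc22p : 0 < c22 := (right_ne_zero_of_mul hne).symm.lt_of_le
    (hc22 ▸ sum_nonneg fun i _ => mul_self_nonneg _)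
  have hx : 0 < (n1 : ℝ) * c11 := mul_pos (by exact_mod_cast hn1p) hc11p
  have hy : 0 < (n2 : ℝ) * c22 := mul_pos (by exact_mod_cast hn2p) hc22p
  rw [h12, zero_smul, add_zero] at hH
  have hclass : ∀ (d : ℝ) (u : Fin n → ℝ), d ≠ 0 → u ≠ 0 → H *ᵥ u = d • u →
      (d = n1 * c11 ∧ ∃ t : ℝ, t ≠ 0 ∧ u = t • a1) ∨
        (d = n2 * c22 ∧ ∃ t : ℝ, t ≠ 0 ∧ u = t • a2) := by
    intro d u hd hu h
    have := eq_smul_of_orthogonal_rank_two_mulVec_eq hortho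
      (by rwa [hs1, hs2, mul_comm c11, mul_comm c22]) hd hu (hH ▸ h)
    rwa [hs1, hs2, mul_comm c11, mul_comm c22] at this
  have hpower : ∀ (d : ℝ) (u : Fin n → ℝ), 0 < d → u ≠ 0 → H *ᵥ u = d • u →
      HasClusteringPower u d := by
    intro d u hd hu h
    refine ⟨hd, ?_⟩
    rcases hclass d u hd.ne' hu h with ⟨-, t, ht, rfl⟩ | ⟨-, t, ht, rfl⟩
    · exact card_image_smul_zero_one ha1 hzero1 hone1 ht
    · exact card_image_smul_zero_one ha2' hzero2 hone2 ht
  obtain ⟨hherm, i, j, hij, rfl, rfl, hle, htop⟩ := htop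
  have hval : ∀ k, hherm.eigenvalues k = 0 ∨ hherm.eigenvalues k = n1 * c11 ∨
      hherm.eigenvalues k = n2 * c22 := by
    intro k
    by_cases hk : hherm.eigenvalues k = 0
    · exact Or.inl hk
    · exact Or.inr ((hclass _ _ hk
        (fun h0 => hherm.eigenvectorBasis.orthonormal.ne_zero k (WithLp.ofLp_injective 2 h0))
        (hherm.mulVec_eigenvectorBasis k)).imp And.left And.left)
  have hv1 : H *ᵥ a1 = ((n1 : ℝ) * c11) • a1 := by
    rw [hH, mul_comm, mul_smul, ← hs1]
    simp [add_mulVec, smul_mulVec, vecMulVec_mulVec, dotProduct_comm a2 a1, hortho]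
  have hv2 : H *ᵥ a2 = ((n2 : ℝ) * c22) • a2 := by
    rw [hH, mul_comm, mul_smul, ← hs2]
    simp [add_mulVec, smul_mulVec, vecMulVec_mulVec, hortho]
  have hane1 : a1 ≠ 0 := fun h => by simp [h] at hone1
  have hane2 : a2 ≠ 0 := fun h => by simp [h] at hone2
  obtain ⟨hi, hj⟩ := top_two_eq_max_min hx hy hne2 hval
    (hherm.exists_eigenvalues_eq_of_mulVec_eq_smul hane1 hv1)
    (hherm.exists_eigenvalues_eq_of_mulVec_eq_smul hane2 hv2)
    (fun k l => hherm.eq_of_eigenvalues_eq_of_forall_eq_smul fun u hu h =>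
      ((hclass _ u hx.ne' hu h).resolve_right fun h' => hne2 h'.1).2)
    (fun k l => hherm.eq_of_eigenvalues_eq_of_forall_eq_smul fun u hu h =>
      ((hclass _ u hy.ne' hu h).resolve_left fun h' => hne2 h'.1.symm).2)
    hij hle htop
  have hjpos : 0 < hherm.eigenvalues j := hj ▸ lt_min hx hy
  exact ⟨hi, hj, hjpos, fun u => hpower _ u (hjpos.trans_le hle), fun u => hpower _ u hjpos⟩
end

section
/- Suppose c12 ≠ 0 and c12² ≠ c11·c22, and let u1 and u2 be eigenvectors of H corresponding to d1² and d2² respectively. If n1·c11 + n2·c12 = n2·c22 + n1·c12, then exactly one of u1 and u2 has clustering power; if n1·c11 + n2·c12 ≠ n2·c22 + n1·c12, then both u1 and u2 have clustering power. -/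
open Matrix Finset

section BlockGram

variable {n : ℕ}

/-- The Gram matrix of a two-cluster mean matrix with membership vectors `a` and `b`. -/
def blockGram (a b : Fin n → ℝ) (c11 c22 c12 : ℝ) : Matrix (Fin n) (Fin n) ℝ :=
  c11 • vecMulVec a a + c22 • vecMulVec b b + c12 • (vecMulVec a b + vecMulVec b a)

lemma blockGram_mulVec (a b v : Fin n → ℝ) (c11 c22 c12 : ℝ) :
    blockGram a b c11 c22 c12 *ᵥ v =
      (c11 * (a ⬝ᵥ v) + c12 * (b ⬝ᵥ v)) • a + (c12 * (a ⬝ᵥ v) + c22 * (b ⬝ᵥ v)) • b := by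
  ext i
  simp only [blockGram, add_mulVec, smul_mulVec, vecMulVec_mulVec, Pi.add_apply, Pi.smul_apply,
    smul_eq_mul, MulOpposite.smul_eq_mul_unop, MulOpposite.unop_op]
  ring

lemma blockGram_eigenvector_eq {a b v : Fin n → ℝ} {c11 c22 c12 d : ℝ} (hab : a ⬝ᵥ b = 0)
    (hd : d ≠ 0) (hv : blockGram a b c11 c22 c12 *ᵥ v = d • v) :
    ∃ x y : ℝ, v = x • a + y • b ∧
      c11 * ((a ⬝ᵥ a) * x) + c12 * ((b ⬝ᵥ b) * y) = d * x ∧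
      c12 * ((a ⬝ᵥ a) * x) + c22 * ((b ⬝ᵥ b) * y) = d * y := by
  rw [blockGram_mulVec] at hv
  set α := c11 * (a ⬝ᵥ v) + c12 * (b ⬝ᵥ v)
  set β := c12 * (a ⬝ᵥ v) + c22 * (b ⬝ᵥ v)
  have hve : v = (α / d) • a + (β / d) • b := by
    rw [← inv_smul_smul₀ hd v, ← hv, smul_add, smul_smul, smul_smul, div_eq_inv_mul,
      div_eq_inv_mul]
  have hba : b ⬝ᵥ a = 0 := by rw [dotProduct_comm, hab]
  have hav : a ⬝ᵥ v = (a ⬝ᵥ a) * (α / d) := by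
    conv_lhs => rw [hve]
    simp [dotProduct_add, dotProduct_smul, hab, mul_comm]
  have hbv : b ⬝ᵥ v = (b ⬝ᵥ b) * (β / d) := by
    conv_lhs => rw [hve]
    simp [dotProduct_add, dotProduct_smul, hba, mul_comm]
  refine ⟨α / d, β / d, hve, ?_, ?_⟩
  · rw [← hav, ← hbv, mul_div_cancel₀ _ hd]
  · rw [← hav, ← hbv, mul_div_cancel₀ _ hd]

lemma blockGram_eigenvalue_simple {a b v w : Fin n → ℝ} {c11 c22 c12 d : ℝ} (hab : a ⬝ᵥ b = 0)
    (ha : 0 < a ⬝ᵥ a) (hb : 0 < b ⬝ᵥ b) (h12 : c12 ≠ 0) (hd : d ≠ 0)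
    (hv : blockGram a b c11 c22 c12 *ᵥ v = d • v)
    (hw : blockGram a b c11 c22 c12 *ᵥ w = d • w)
    (hvw : v ⬝ᵥ w = 0) : v = 0 ∨ w = 0 := by
  obtain ⟨x, y, rfl, h1, -⟩ := blockGram_eigenvector_eq hab hd hv
  obtain ⟨x', y', rfl, h1', -⟩ := blockGram_eigenvector_eq hab hd hw
  have hba : b ⬝ᵥ a = 0 := by rw [dotProduct_comm, hab]
  have hort : (a ⬝ᵥ a) * (x * x') + (b ⬝ᵥ b) * (y * y') = 0 := by
    simp only [dotProduct_add, add_dotProduct, dotProduct_smul, smul_dotProduct, hab, hba,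
      smul_eq_mul] at hvw
    linarith
  have hpar : x * y' = x' * y := by
    refine mul_left_cancel₀ (mul_ne_zero h12 hb.ne') ?_
    linear_combination x * h1' - x' * h1
  by_cases h0 : x = 0 ∧ y = 0
  · left; simp [h0.1, h0.2]
  right
  have hpos : 0 < (a ⬝ᵥ a) * x ^ 2 + (b ⬝ᵥ b) * y ^ 2 := by
    rcases not_and_or.mp h0 with h | h <;> positivity
  have hx' : x' = 0 := by
    refine (mul_eq_zero.mp ?_).resolve_left hpos.ne'
    linear_combination x * hort - (b ⬝ᵥ b) * y * hpar
  have hy' : y' = 0 := by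
    refine (mul_eq_zero.mp ?_).resolve_left hpos.ne'
    linear_combination y * hort + (a ⬝ᵥ a) * x * hpar
  simp [hx', hy']

lemma blockGram_quadraticForm_nonneg {p : ℕ} (a b v : Fin n → ℝ) (μ1 μ2 : Fin p → ℝ) :
    0 ≤ v ⬝ᵥ (blockGram a b (μ1 ⬝ᵥ μ1) (μ2 ⬝ᵥ μ2) (μ1 ⬝ᵥ μ2) *ᵥ v) := by
  have h : 0 ≤ ((a ⬝ᵥ v) • μ1 + (b ⬝ᵥ v) • μ2) ⬝ᵥ ((a ⬝ᵥ v) • μ1 + (b ⬝ᵥ v) • μ2) :=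
    Finset.sum_nonneg fun i _ => mul_self_nonneg _
  rw [blockGram_mulVec]
  simp only [dotProduct_add, add_dotProduct, dotProduct_smul, smul_dotProduct, smul_eq_mul,
    dotProduct_comm v, dotProduct_comm μ2 μ1] at h ⊢
  linarith

lemma dotProduct_eq_zero_of_blockGram_mulVec_eq_zero {a b v : Fin n → ℝ} {c11 c22 c12 : ℝ}
    (hab : a ⬝ᵥ b = 0) (ha : 0 < a ⬝ᵥ a) (hb : 0 < b ⬝ᵥ b) (hne : c12 ^ 2 ≠ c11 * c22)
    (hv : blockGram a b c11 c22 c12 *ᵥ v = 0) : a ⬝ᵥ v = 0 ∧ b ⬝ᵥ v = 0 := by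
  rw [blockGram_mulVec] at hv
  have hba : b ⬝ᵥ a = 0 := by rw [dotProduct_comm, hab]
  have h1 : c11 * (a ⬝ᵥ v) + c12 * (b ⬝ᵥ v) = 0 := by
    have := congrArg (a ⬝ᵥ ·) hv
    simpa [dotProduct_add, dotProduct_smul, hab, ha.ne'] using this
  have h2 : c12 * (a ⬝ᵥ v) + c22 * (b ⬝ᵥ v) = 0 := by
    have := congrArg (b ⬝ᵥ ·) hv
    simpa [dotProduct_add, dotProduct_smul, hba, hb.ne'] using this
  constructor
  · refine (mul_eq_zero.mp ?_).resolve_left (sub_ne_zero.mpr hne)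
    linear_combination c12 * h2 - c22 * h1
  · refine (mul_eq_zero.mp ?_).resolve_left (sub_ne_zero.mpr hne)
    linear_combination c12 * h1 - c11 * h2

lemma blockGram_topTwoEigen {p : ℕ} {a b : Fin n → ℝ} {μ1 μ2 : Fin p → ℝ} {d1 d2 : ℝ}
    (hab : a ⬝ᵥ b = 0) (ha : 0 < a ⬝ᵥ a) (hb : 0 < b ⬝ᵥ b) (h12 : μ1 ⬝ᵥ μ2 ≠ 0)
    (hne : (μ1 ⬝ᵥ μ2) ^ 2 ≠ (μ1 ⬝ᵥ μ1) * (μ2 ⬝ᵥ μ2))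
    (htop : IsTopTwoEigen (blockGram a b (μ1 ⬝ᵥ μ1) (μ2 ⬝ᵥ μ2) (μ1 ⬝ᵥ μ2)) d1 d2) :
    0 < d2 ∧ d2 < d1 := by
  obtain ⟨hH, i, j, hij, rfl, rfl, hle, htop⟩ := htop
  have hdot (k l : Fin n) : (hH.eigenvectorBasis k).ofLp ⬝ᵥ (hH.eigenvectorBasis l).ofLp =
      if k = l then 1 else 0 := by
    have h := orthonormal_iff_ite.mp hH.eigenvectorBasis.orthonormal l k
    simpa [EuclideanSpace.inner_eq_star_dotProduct, eq_comm] using h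
  have hparseval (f g : Fin n → ℝ) : f ⬝ᵥ g =
      ∑ k, (f ⬝ᵥ (hH.eigenvectorBasis k).ofLp) * (g ⬝ᵥ (hH.eigenvectorBasis k).ofLp) := by
    have h := hH.eigenvectorBasis.sum_inner_mul_inner (WithLp.toLp 2 f) (WithLp.toLp 2 g)
    simp only [EuclideanSpace.inner_eq_star_dotProduct, star_trivial] at h
    rw [dotProduct_comm, ← h]
    simp only [dotProduct_comm]
  have hnonneg (k : Fin n) : 0 ≤ hH.eigenvalues k := by
    have h := blockGram_quadraticForm_nonneg a b (hH.eigenvectorBasis k).ofLp μ1 μ2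
    rw [hH.mulVec_eigenvectorBasis, dotProduct_smul, hdot] at h
    simpa using h
  have hpos : 0 < hH.eigenvalues j := by
    by_contra! hj
    have hker (k : Fin n) (hk : k ≠ i) : a ⬝ᵥ (hH.eigenvectorBasis k).ofLp = 0 ∧
        b ⬝ᵥ (hH.eigenvectorBasis k).ofLp = 0 := by
      apply dotProduct_eq_zero_of_blockGram_mulVec_eq_zero hab ha hb hne
      have hk0 : hH.eigenvalues k = 0 := by
        refine le_antisymm ?_ (hnonneg k)
        by_cases hkj : k = j
        · exact hkj ▸ hj
        · exact (htop k hk hkj).trans hj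
      rw [hH.mulVec_eigenvectorBasis, hk0, zero_smul]
    have hsingle {f g : Fin n → ℝ} (hf : ∀ k, k ≠ i → f ⬝ᵥ (hH.eigenvectorBasis k).ofLp = 0) :
        f ⬝ᵥ g = (f ⬝ᵥ (hH.eigenvectorBasis i).ofLp) * (g ⬝ᵥ (hH.eigenvectorBasis i).ofLp) := by
      rw [hparseval]
      refine Finset.sum_eq_single i (fun k _ hk => ?_) (by simp)
      rw [hf k hk, zero_mul]
    rw [hsingle fun k hk => (hker k hk).1] at hab ha
    rw [hsingle fun k hk => (hker k hk).2] at hb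
    rcases mul_eq_zero.mp hab with h | h
    · simp [h] at ha
    · simp [h] at hb
  refine ⟨hpos, lt_of_le_of_ne hle fun heq => ?_⟩
  have hne0 (k : Fin n) : (hH.eigenvectorBasis k).ofLp ≠ 0 := fun h => by
    simpa [h] using hdot k k
  rcases blockGram_eigenvalue_simple hab ha hb h12 hpos.ne'
    (heq ▸ hH.mulVec_eigenvectorBasis i) (hH.mulVec_eigenvectorBasis j)
    (by rw [hdot, if_neg hij]) with h | h
  · exact hne0 i h
  · exact hne0 j h

end BlockGram

lemma dotProduct_self_eq_card_of_zero_or_one {ι : Type*} [Fintype ι] {a : ι → ℝ}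
    (ha : ∀ i, a i = 0 ∨ a i = 1) :
    a ⬝ᵥ a = ((Finset.univ.filter fun i => a i = 1).card : ℝ) := by
  rw [Finset.card_filter, Nat.cast_sum]
  refine Finset.sum_congr rfl fun i _ => ?_
  rcases ha i with h | h <;> simp [h]

lemma card_image_two_blocks {n : ℕ} {a b : Fin n → ℝ}
    (hab : ∀ i, a i = 0 ∧ b i = 1 ∨ a i = 1 ∧ b i = 0)
    (ha : ∃ i, a i = 1) (hb : ∃ i, b i = 1) (x y : ℝ) :
    (Finset.univ.image (x • a + y • b)).card = 2 ↔ x ≠ y := by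
  have himage : Finset.univ.image (x • a + y • b) = {x, y} := by
    ext z
    simp only [Finset.mem_image, Finset.mem_univ, true_and, Finset.mem_insert,
      Finset.mem_singleton, Pi.add_apply, Pi.smul_apply, smul_eq_mul]
    constructor
    · rintro ⟨i, rfl⟩
      rcases hab i with ⟨h, h'⟩ | ⟨h, h'⟩ <;> simp [h, h']
    · obtain ⟨i, hi⟩ := ha
      obtain ⟨j, hj⟩ := hb
      rintro (rfl | rfl)
      · refine ⟨i, ?_⟩
        rcases hab i with ⟨h, h'⟩ | ⟨h, h'⟩ <;> simp_all
      · refine ⟨j, ?_⟩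
        rcases hab j with ⟨h, h'⟩ | ⟨h, h'⟩ <;> simp_all
  rw [himage]
  constructor
  · rintro h rfl
    simp at h
  · exact Finset.card_pair

theorem general_case_clustering_power
    (n p : ℕ) (hn : 2 ≤ n)
    (a1 : Fin n → ℝ) (ha1 : ∀ i, a1 i = 0 ∨ a1 i = 1)
    (a2 : Fin n → ℝ) (ha2 : a2 = fun i => 1 - a1 i)
    (n1 n2 : ℕ)
    (hn1 : n1 = (Finset.univ.filter (fun i => a1 i = 1)).card)
    (hn2 : n2 = n - n1)
    (hn1p : 1 ≤ n1) (hn2p : 1 ≤ n2)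
    (μ1 μ2 : Fin p → ℝ) (hμ : μ1 ≠ μ2) (hμ2 : μ2 ≠ 0)
    (c11 c22 c12 : ℝ)
    (hc11 : c11 = μ1 ⬝ᵥ μ1) (hc22 : c22 = μ2 ⬝ᵥ μ2) (hc12 : c12 = μ1 ⬝ᵥ μ2)
    (H : Matrix (Fin n) (Fin n) ℝ)
    (hH : H = c11 • vecMulVec a1 a1 + c22 • vecMulVec a2 a2 +
      c12 • (vecMulVec a1 a2 + vecMulVec a2 a1))
    (d1sq d2sq : ℝ) (htop : IsTopTwoEigen H d1sq d2sq)
    (h12 : c12 ≠ 0) (hne : c12 ^ 2 ≠ c11 * c22) :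
    ∀ u1 u2 : Fin n → ℝ, u1 ≠ 0 → u2 ≠ 0 →
      H *ᵥ u1 = d1sq • u1 → H *ᵥ u2 = d2sq • u2 →
      (((n1 : ℝ) * c11 + (n2 : ℝ) * c12 = (n2 : ℝ) * c22 + (n1 : ℝ) * c12 →
        Xor' (HasClusteringPower u1 d1sq) (HasClusteringPower u2 d2sq)) ∧
       ((n1 : ℝ) * c11 + (n2 : ℝ) * c12 ≠ (n2 : ℝ) * c22 + (n1 : ℝ) * c12 →
        HasClusteringPower u1 d1sq ∧ HasClusteringPower u2 d2sq)) := by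
  intro u1 u2 hu1 hu2 hHu1 hHu2
  have ha2' (i : Fin n) : a2 i = 1 - a1 i := congrFun ha2 i
  have hblocks (i : Fin n) : a1 i = 0 ∧ a2 i = 1 ∨ a1 i = 1 ∧ a2 i = 0 := by
    rcases ha1 i with h | h <;> simp [ha2', h]
  have hm1 : a1 ⬝ᵥ a1 = n1 := by rw [hn1, dotProduct_self_eq_card_of_zero_or_one ha1]
  have hab : a1 ⬝ᵥ a2 = 0 :=
    Finset.sum_eq_zero fun i _ => by rcases hblocks i with h | h <;> simp [h]
  have hm2 : a2 ⬝ᵥ a2 = n2 := by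
    have hsum : a1 ⬝ᵥ a1 + a2 ⬝ᵥ a2 = n := by
      rw [dotProduct, dotProduct, ← Finset.sum_add_distrib]
      calc _ = ∑ _i : Fin n, (1 : ℝ) :=
            Finset.sum_congr rfl fun i _ => by rcases hblocks i with h | h <;> simp [h]
        _ = n := by simp
    rw [hn2, Nat.cast_sub (by lia)]
    linarith
  have hp1 : (0 : ℝ) < n1 := by exact_mod_cast hn1p
  have hp2 : (0 : ℝ) < n2 := by exact_mod_cast hn2p
  have hex1 : ∃ i, a1 i = 1 := by
    obtain ⟨i, hi⟩ := Finset.card_pos.mp (hn1 ▸ hn1p)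
    exact ⟨i, (Finset.mem_filter.mp hi).2⟩
  have hex2 : ∃ i, a2 i = 1 := by
    by_contra! h
    have h0 : a2 = 0 := funext fun i => ((hblocks i).resolve_left fun h' => h i h'.2).2
    simp [h0, hp2.ne] at hm2
  obtain ⟨hd2, hlt⟩ : 0 < d2sq ∧ d2sq < d1sq := by
    subst hc11 hc22 hc12 hH
    exact blockGram_topTwoEigen hab (hm1 ▸ hp1) (hm2 ▸ hp2) h12 hne htop
  have hd1 := hd2.trans hlt
  have hcard := card_image_two_blocks hblocks hex1 hex2
  rw [hH] at hHu1 hHu2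
  obtain ⟨x1, y1, rfl, h11, h12'⟩ := blockGram_eigenvector_eq hab hd1.ne' hHu1
  obtain ⟨x2, y2, rfl, h21, h22⟩ := blockGram_eigenvector_eq hab hd2.ne' hHu2
  rw [hm1, hm2] at h11 h12' h21 h22
  simp only [HasClusteringPower, hd1, hd2, true_and, hcard]
  have hconst {x y d : ℝ} (hu : x • a1 + y • a2 ≠ 0) (hxy : x = y)
      (h1 : c11 * (n1 * x) + c12 * (n2 * y) = d * x)
      (h2 : c12 * (n1 * x) + c22 * (n2 * y) = d * y) :
      d = n1 * c11 + n2 * c12 ∧ d = n2 * c22 + n1 * c12 := by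
    subst hxy
    have hx : x ≠ 0 := fun h => hu (by simp [h])
    exact ⟨mul_right_cancel₀ hx (by linear_combination -h1),
      mul_right_cancel₀ hx (by linear_combination -h2)⟩
  refine ⟨fun heq => ?_, fun hneq => ⟨fun h => ?_, fun h => ?_⟩⟩
  · have hnonconst {x y d : ℝ} (hxy : x ≠ y)
        (h1 : c11 * (n1 * x) + c12 * (n2 * y) = d * x)
        (h2 : c12 * (n1 * x) + c22 * (n2 * y) = d * y) : d = n1 * (c11 - c12) :=
      mul_right_cancel₀ (sub_ne_zero.mpr hxy) (by linear_combination h2 - h1 + y * heq)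
    by_cases hxy1 : x1 = y1
    · refine Or.inr ⟨fun hxy2 => hlt.ne ?_, not_not.mpr hxy1⟩
      rw [(hconst hu2 hxy2 h21 h22).1, (hconst hu1 hxy1 h11 h12').1]
    · refine Or.inl ⟨hxy1, fun hxy2 => hlt.ne ?_⟩
      rw [hnonconst hxy2 h21 h22, hnonconst hxy1 h11 h12']
  · have := hconst hu1 h h11 h12'
    exact hneq (this.1.symm.trans this.2)
  · have := hconst hu2 h h21 h22
    exact hneq (this.1.symm.trans this.2)
end

section
/- Let u ∈ ℝⁿ be an eigenvector of H with eigenvalue d² > 0, i.e. Hu = d²u with u ≠ 0. Then u is constant on each class: for all indices i, j, if a1(i) = a1(j) then u(i) = u(j). In particular the coordinates of u take at most two distinct values. -/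
open Matrix Finset

theorem eigenvector_constant_on_classes
    (n p : ℕ) (hn : 2 ≤ n)
    (a1 : Fin n → ℝ) (ha1 : ∀ i, a1 i = 0 ∨ a1 i = 1)
    (a2 : Fin n → ℝ) (ha2 : a2 = fun i => 1 - a1 i)
    (n1 n2 : ℕ)
    (hn1 : n1 = (Finset.univ.filter (fun i => a1 i = 1)).card)
    (hn2 : n2 = n - n1)
    (hn1p : 1 ≤ n1) (hn2p : 1 ≤ n2)
    (μ1 μ2 : Fin p → ℝ)
    (c11 c22 c12 : ℝ)
    (hc11 : c11 = μ1 ⬝ᵥ μ1) (hc22 : c22 = μ2 ⬝ᵥ μ2) (hc12 : c12 = μ1 ⬝ᵥ μ2)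
    (H : Matrix (Fin n) (Fin n) ℝ)
    (hH : H = c11 • vecMulVec a1 a1 + c22 • vecMulVec a2 a2 +
      c12 • (vecMulVec a1 a2 + vecMulVec a2 a1))
    (u : Fin n → ℝ) (hu : u ≠ 0)
    (dsq : ℝ) (hdsq : 0 < dsq)
    (heig : H *ᵥ u = dsq • u) :
    (∀ i j : Fin n, a1 i = a1 j → u i = u j) ∧
    (Finset.univ.image u).card ≤ 2 := by
  have hconst : ∀ i j : Fin n, a1 i = a1 j → u i = u j := by
    intro i j hij
    have hrow : H i = H j := by
      ext k
      simp [hH, ha2, vecMulVec_apply, hij]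
    have hi : (H *ᵥ u) i = dsq * u i := by simp [heig]
    have hj : (H *ᵥ u) j = dsq * u j := by simp [heig]
    refine mul_left_cancel₀ hdsq.ne' ?_
    rw [← hi, ← hj, mulVec, mulVec, hrow]
  refine ⟨hconst, ?_⟩
  obtain ⟨g, rfl⟩ : ∃ g : ℝ → ℝ, u = g ∘ a1 :=
    (Function.factorsThrough_iff u).1 fun i j hij => hconst i j hij
  calc (univ.image (g ∘ a1)).card = ((univ.image a1).image g).card := by rw [image_image]
    _ ≤ (univ.image a1).card := card_image_le
    _ ≤ ({0, 1} : Finset ℝ).card := card_le_card fun x hx => by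
        obtain ⟨i, -, rfl⟩ := mem_image.1 hx
        simpa using ha1 i
    _ ≤ 2 := card_le_two
end
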